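/- For all n, m ≥ 0 and all permutations π ∈ S_n and τ ∈ S_m, the fundamental bijection commutes with direct sums: θ(π ⊕ τ) = θ(π) ⊕ θ(τ), where θ is applied in S_{n+m} on the left and in S_n and S_m on the right. -/

import Mathlib

/-- The one-line word of the image of `π` under the fundamental bijection:
write `π` in standard cycle form (every cycle written with its largest element
first, cycles listed in increasing order of their largest elements) and erase
the parentheses.  The cycle maxima are exactly the `x` with `π^[k] x ≤ x` for
all `k`, and the cycle of `x` is `x, π x, π² x, …` up to the period of `x`. -/
noncomputable def fundWord {n : ℕ} (π : Equiv.Perm (Fin n)) : List (Fin n) :=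
  ((List.finRange n).filter fun x => (List.range n).all fun k => decide ((⇑π)^[k] x ≤ x)).flatMap
    fun x => (List.range (Function.minimalPeriod (⇑π) x)).map fun k => (⇑π)^[k] x

/-- The permutation whose one-line notation is the word `w`
(junk value if `w` is not the one-line notation of a permutation). -/
noncomputable def permOfWord {n : ℕ} (w : List (Fin n)) : Equiv.Perm (Fin n) :=
  Function.invFun (fun σ : Equiv.Perm (Fin n) => (List.finRange n).map ⇑σ) w

/-- The fundamental bijection `θ`. -/
noncomputable def theta {n : ℕ} (π : Equiv.Perm (Fin n)) : Equiv.Perm (Fin n) :=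
  permOfWord (fundWord π)

/-- `π` contains the pattern `σ`. -/
def Contains {k n : ℕ} (σ : Equiv.Perm (Fin k)) (π : Equiv.Perm (Fin n)) : Prop :=
  ∃ f : Fin k → Fin n, StrictMono f ∧ ∀ a b : Fin k, π (f a) < π (f b) ↔ σ a < σ b

/-- `π` avoids the pattern `σ`. -/
def Avoids {k n : ℕ} (π : Equiv.Perm (Fin n)) (σ : Equiv.Perm (Fin k)) : Prop :=
  ¬ Contains σ π

noncomputable def p123 : Equiv.Perm (Fin 3) := Equiv.ofBijective ![0, 1, 2] (by decide)
noncomputable def p132 : Equiv.Perm (Fin 3) := Equiv.ofBijective ![0, 2, 1] (by decide)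
noncomputable def p213 : Equiv.Perm (Fin 3) := Equiv.ofBijective ![1, 0, 2] (by decide)
noncomputable def p231 : Equiv.Perm (Fin 3) := Equiv.ofBijective ![1, 2, 0] (by decide)
noncomputable def p312 : Equiv.Perm (Fin 3) := Equiv.ofBijective ![2, 0, 1] (by decide)
noncomputable def p321 : Equiv.Perm (Fin 3) := Equiv.ofBijective ![2, 1, 0] (by decide)

/-- The direct sum `π ⊕ τ` of two permutations. -/
def directSum {n m : ℕ} (π : Equiv.Perm (Fin n)) (τ : Equiv.Perm (Fin m)) :
    Equiv.Perm (Fin (n + m)) :=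
  finSumFinEquiv.permCongr (Equiv.sumCongr π τ)

/-- A permutation is irreducible if it is not a direct sum of two nonempty permutations. -/
def IrreduciblePerm {n : ℕ} (π : Equiv.Perm (Fin n)) : Prop :=
  ¬ ∃ (a b : ℕ) (_ : 0 < a) (_ : 0 < b) (h : a + b = n)
      (σ : Equiv.Perm (Fin a)) (τ : Equiv.Perm (Fin b)),
      π = (finCongr h).permCongr (directSum σ τ)

/-- A permutation is cyclic if its cycle decomposition is a single cycle of full length,
i.e. it acts transitively. -/
def IsCyclicPerm {n : ℕ} (π : Equiv.Perm (Fin n)) : Prop :=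
  ∀ x y : Fin n, ∃ k : ℕ, (⇑π)^[k] x = y

open Function

theorem directSum_castAdd {n m : ℕ} (π : Equiv.Perm (Fin n)) (τ : Equiv.Perm (Fin m))
    (x : Fin n) : directSum π τ (Fin.castAdd m x) = Fin.castAdd m (π x) := by
  simp [directSum, Equiv.permCongr_apply]

theorem directSum_natAdd {n m : ℕ} (π : Equiv.Perm (Fin n)) (τ : Equiv.Perm (Fin m))
    (x : Fin m) : directSum π τ (Fin.natAdd n x) = Fin.natAdd n (τ x) := by
  simp [directSum, Equiv.permCongr_apply]

theorem exists_iterate_symm {n : ℕ} (π : Equiv.Perm (Fin n)) {x y : Fin n} {k : ℕ}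
    (h : (⇑π)^[k] x = y) : ∃ j, (⇑π)^[j] y = x := by
  obtain ⟨p, hp, hx⟩ := π.injective.mem_periodicPts x
  refine ⟨p * k - k, ?_⟩
  rw [← h, ← iterate_add_apply, Nat.sub_add_cancel (Nat.le_mul_of_pos_left k hp)]
  exact hx.mul_const k

theorem minimalPeriod_pos_of_perm {n : ℕ} (π : Equiv.Perm (Fin n)) (x : Fin n) :
    0 < minimalPeriod π x :=
  minimalPeriod_pos_of_mem_periodicPts (π.injective.mem_periodicPts x)

theorem minimalPeriod_le_of_perm {n : ℕ} (π : Equiv.Perm (Fin n)) (x : Fin n) :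
    minimalPeriod π x ≤ n := by
  have h := Finset.card_le_card_of_injOn (s := Finset.range (minimalPeriod π x))
    (t := Finset.univ) (fun k => (⇑π)^[k] x) (by simp)
    (by simpa using iterate_injOn_Iio_minimalPeriod)
  simpa using h

theorem all_iterate_le_iff {n : ℕ} (π : Equiv.Perm (Fin n)) (x : Fin n) {N : ℕ} (hN : n ≤ N) :
    ((List.range N).all fun k => decide ((⇑π)^[k] x ≤ x)) = true ↔ ∀ k, (⇑π)^[k] x ≤ x := by
  simp only [List.all_eq_true, List.mem_range, decide_eq_true_eq]
  refine ⟨fun h k => ?_, fun h k _ => h k⟩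
  rw [← iterate_mod_minimalPeriod_eq]
  exact h _ ((Nat.mod_lt _ (minimalPeriod_pos_of_perm π x)).trans_le
    ((minimalPeriod_le_of_perm π x).trans hN))

theorem mem_fundWord {n : ℕ} (π : Equiv.Perm (Fin n)) (y : Fin n) : y ∈ fundWord π := by
  obtain ⟨_, ⟨i, rfl⟩, hi⟩ := Set.exists_max_image (Set.range fun i => (⇑π)^[i] y) id
    (Set.toFinite _) ⟨_, 0, rfl⟩
  obtain ⟨j, hj⟩ := exists_iterate_symm π (x := y) (k := i) rfl
  simp only [fundWord, List.mem_flatMap, List.mem_filter, List.mem_map, List.mem_range]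
  refine ⟨(⇑π)^[i] y, ⟨List.mem_finRange _, (all_iterate_le_iff π _ le_rfl).2 fun k => ?_⟩,
    j % minimalPeriod π ((⇑π)^[i] y), Nat.mod_lt _ (minimalPeriod_pos_of_perm π _), ?_⟩
  · rw [← iterate_add_apply]
    exact hi _ ⟨k + i, rfl⟩
  · rw [iterate_mod_minimalPeriod_eq, hj]

theorem nodup_fundWord {n : ℕ} (π : Equiv.Perm (Fin n)) : (fundWord π).Nodup := by
  refine List.nodup_flatMap.2 ⟨fun x _ => ?_, ?_⟩
  · refine List.Nodup.map_on (fun a ha b hb hab => ?_) List.nodup_range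
    exact iterate_injOn_Iio_minimalPeriod (List.mem_range.1 ha) (List.mem_range.1 hb) hab
  · refine ((List.nodup_finRange n).filter _).imp_of_mem fun {a b} ha hb hab => ?_
    have ha := (all_iterate_le_iff π a le_rfl).1 (List.mem_filter.1 ha).2
    have hb := (all_iterate_le_iff π b le_rfl).1 (List.mem_filter.1 hb).2
    intro z hza hzb
    obtain ⟨i, -, hi⟩ := List.mem_map.1 hza
    obtain ⟨j, -, hj⟩ := List.mem_map.1 hzb
    obtain ⟨i', hi'⟩ := exists_iterate_symm π hi
    obtain ⟨j', hj'⟩ := exists_iterate_symm π hj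
    apply hab
    apply le_antisymm
    · rw [← hi', ← hj, ← iterate_add_apply]
      exact hb _
    · rw [← hj', ← hi, ← iterate_add_apply]
      exact ha _

theorem exists_perm_map_finRange {n : ℕ} {w : List (Fin n)} (hw : w.Nodup) (h : ∀ x, x ∈ w) :
    ∃ σ : Equiv.Perm (Fin n), (List.finRange n).map σ = w := by
  let e := hw.getEquivOfForallMemList w h
  have hn : n = w.length := by simpa using (Fintype.card_congr e).symm
  refine ⟨(finCongr hn).trans e, List.ext_getElem (by simpa using hn) fun i _ _ => ?_⟩
  simp [e]

theorem map_finRange_injective (n : ℕ) :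
    Injective fun σ : Equiv.Perm (Fin n) => (List.finRange n).map σ := fun _ _ h =>
  Equiv.ext fun x => List.map_inj_left.1 h x (List.mem_finRange x)

theorem map_finRange_theta {n : ℕ} (π : Equiv.Perm (Fin n)) :
    (List.finRange n).map (theta π) = fundWord π :=
  invFun_eq (f := fun σ : Equiv.Perm (Fin n) => (List.finRange n).map σ)
    (exists_perm_map_finRange (nodup_fundWord π) (mem_fundWord π))

theorem finRange_add_eq_append (n m : ℕ) : List.finRange (n + m) =
    (List.finRange n).map (Fin.castAdd m) ++ (List.finRange m).map (Fin.natAdd n) := by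
  refine List.ext_getElem (by simp) fun i _ _ => ?_
  simp only [List.getElem_finRange, List.getElem_append, List.getElem_map]
  split_ifs with h <;> ext <;> simp at h ⊢
  omega

/-- A block of cycles transported along an order embedding that intertwines two permutations. -/
theorem flatMap_cycles_map {n N : ℕ} (π : Equiv.Perm (Fin n)) (ρ : Equiv.Perm (Fin N))
    (f : Fin n ↪o Fin N) (h : Semiconj f π ρ) :
    (((List.finRange n).map f).filter fun x =>
        (List.range N).all fun k => decide ((⇑ρ)^[k] x ≤ x)).flatMap
      (fun x => (List.range (minimalPeriod ρ x)).map fun k => (⇑ρ)^[k] x) =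
    (fundWord π).map f := by
  have hN : n ≤ N := by simpa using Fintype.card_le_of_embedding f.toEmbedding
  have hi (k : ℕ) (x : Fin n) : (⇑ρ)^[k] (f x) = f ((⇑π)^[k] x) :=
    ((h.iterate_right k) x).symm
  have hp (x : Fin n) : minimalPeriod ρ (f x) = minimalPeriod π x :=
    minimalPeriod_eq_minimalPeriod_iff.2 fun k => by
      simp [IsPeriodicPt, IsFixedPt, hi]
  have hf : ((fun x => (List.range N).all fun k => decide ((⇑ρ)^[k] x ≤ x)) ∘ f) =
      fun x => (List.range n).all fun k => decide ((⇑π)^[k] x ≤ x) := by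
    funext x
    simp only [comp_apply, hi, f.le_iff_le]
    exact Bool.eq_iff_iff.2 ((all_iterate_le_iff π x hN).trans
      (all_iterate_le_iff π x le_rfl).symm)
  rw [List.filter_map, hf, fundWord, List.flatMap_map, List.map_flatMap]
  simp only [hp, hi, List.map_map, comp_def]

theorem fundWord_directSum {n m : ℕ} (π : Equiv.Perm (Fin n)) (τ : Equiv.Perm (Fin m)) :
    fundWord (directSum π τ) =
      (fundWord π).map (Fin.castAdd m) ++ (fundWord τ).map (Fin.natAdd n) := by
  rw [fundWord, finRange_add_eq_append, List.filter_append, List.flatMap_append]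
  exact congrArg₂ _
    (flatMap_cycles_map π _ (Fin.castAddOrderEmb m) fun x => (directSum_castAdd π τ x).symm)
    (flatMap_cycles_map τ _ (Fin.natAddOrderEmb n) fun x => (directSum_natAdd π τ x).symm)

/-- θ commutes with direct sums. -/
theorem theta_directSum (n m : ℕ) (π : Equiv.Perm (Fin n)) (τ : Equiv.Perm (Fin m)) :
    theta (directSum π τ) = directSum (theta π) (theta τ) := by
  refine map_finRange_injective _ ?_
  beta_reduce
  rw [map_finRange_theta, fundWord_directSum, finRange_add_eq_append, List.map_append,
    ← map_finRange_theta π, ← map_finRange_theta τ]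
  simp only [List.map_map, comp_def, directSum_castAdd, directSum_natAdd]
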